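/- arXiv:1401.6516 — 2 statements merged into one kernel-verified Lean document; each statement's English description precedes it below -/
import Mathlib

section
/- For every n ≥ 2 and every positive integer l, the number of (n,2) left Gog trapezoids X with bottom entry X_{1,1} = l equals the number of (n,2) left GOGAm trapezoids Y with bottom entry Y_{1,1} = l. In particular, the (n,2) left Gog trapezoids and the (n,2) left GOGAm trapezoids are equienumerated. -/
/-- A Gelfand-Tsetlin triangle of size `n`: a triangular array of positive integers
`X i j` for `n ≥ i ≥ j ≥ 1` with `X (i+1) j ≤ X i j ≤ X (i+1) (j+1)`. -/
def IsGT (n : ℕ) (X : ℕ → ℕ → ℤ) : Prop :=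
  (∀ i j, 1 ≤ j → j ≤ i → i ≤ n → 1 ≤ X i j) ∧
  (∀ i j, 1 ≤ j → j ≤ i → i + 1 ≤ n → X (i+1) j ≤ X i j ∧ X i j ≤ X (i+1) (j+1))

/-- A Gog triangle of size `n`: a Gelfand-Tsetlin triangle with strictly increasing
rows and top row `X n j = j`. -/
def IsGog (n : ℕ) (X : ℕ → ℕ → ℤ) : Prop :=
  IsGT n X ∧
  (∀ i j, 1 ≤ j → j + 1 ≤ i → i ≤ n → X i j < X i (j+1)) ∧
  (∀ j, 1 ≤ j → j ≤ n → X n j = (j : ℤ))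

/-- A Magog triangle of size `n`. -/
def IsMagog (n : ℕ) (X : ℕ → ℕ → ℤ) : Prop :=
  IsGT n X ∧ ∀ j, 1 ≤ j → j ≤ n → X j j ≤ (j : ℤ)

/-- A GOGAm triangle of size `n`, characterized by the family of inequalities. -/
def IsGogam (n : ℕ) (X : ℕ → ℕ → ℤ) : Prop :=
  IsGT n X ∧ X n n ≤ (n : ℤ) ∧
  ∀ k : ℕ, 1 ≤ k → k ≤ n - 1 →
    ∀ j : ℕ → ℕ, j 0 = n → (∀ i, i < n - k → j (i+1) < j i) → 1 ≤ j (n - k) →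
      (∑ i ∈ Finset.range (n - k),
        (X (j i + i) (j i) - X (j (i+1) + i) (j (i+1))))
        + X (j (n-k) + (n-k)) (j (n-k)) ≤ (k : ℤ)

/-- The number of inversions of `X` (pairs `(i,j)` with `X i j = X (i+1) j`). -/
noncomputable def invCount (n : ℕ) (X : ℕ → ℕ → ℤ) : ℕ :=
  Set.ncard {p : ℕ × ℕ | 1 ≤ p.2 ∧ p.2 ≤ p.1 ∧ p.1 + 1 ≤ n ∧ X p.1 p.2 = X (p.1+1) p.2}

/-- The number of coinversions of `X` (pairs `(i,j)` with `X i j = X (i+1) (j+1)`). -/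
noncomputable def coinvCount (n : ℕ) (X : ℕ → ℕ → ℤ) : ℕ :=
  Set.ncard {p : ℕ × ℕ | 1 ≤ p.2 ∧ p.2 ≤ p.1 ∧ p.1 + 1 ≤ n ∧ X p.1 p.2 = X (p.1+1) (p.2+1)}

/-- Index set of an `(n,k)` left trapezoid: `n ≥ i ≥ j ≥ 1` with `j ≤ k`. -/
def LeftIdx (n k : ℕ) (i j : ℕ) : Prop := 1 ≤ j ∧ j ≤ i ∧ i ≤ n ∧ j ≤ k

/-- `(n,k)` left Gog trapezoids, normalized to vanish outside the trapezoid. -/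
def LeftGogTrapezoids (n k : ℕ) : Set (ℕ → ℕ → ℤ) :=
  {X | (∃ Y, IsGog n Y ∧ ∀ i j, LeftIdx n k i j → X i j = Y i j) ∧
    ∀ i j, ¬ LeftIdx n k i j → X i j = 0}

/-- `(n,k)` left GOGAm trapezoids, normalized to vanish outside the trapezoid. -/
def LeftGogamTrapezoids (n k : ℕ) : Set (ℕ → ℕ → ℤ) :=
  {X | (∃ Y, IsGogam n Y ∧ ∀ i j, LeftIdx n k i j → X i j = Y i j) ∧
    ∀ i j, ¬ LeftIdx n k i j → X i j = 0}

section Walks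

open Finset

/-- Sequences of states starting at `(1, 1)`, whose first `N` steps satisfy `R`, and which vanish
after time `N`. -/
def IsWalk (R : ℕ → ℕ × ℕ → ℕ × ℕ → Prop) (N : ℕ) (f : ℕ → ℕ × ℕ) : Prop :=
  f 0 = (1, 1) ∧ (∀ r < N, R r (f r) (f (r + 1))) ∧ ∀ r, N < r → f r = 0

/-- The states `(x, y)` with `x, y ≤ r + 1`. -/
def stateBox (r : ℕ) : Finset (ℕ × ℕ) := range (r + 2) ×ˢ range (r + 2)

open Classical in
/-- The walks of length `N` ending at `s`, for a relation which keeps the states in the boxes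
`stateBox`. -/
noncomputable def walks (R : ℕ → ℕ × ℕ → ℕ × ℕ → Prop) : ℕ → ℕ × ℕ → Finset (ℕ → ℕ × ℕ)
  | 0, s => if s = (1, 1) then {Function.update (0 : ℕ → ℕ × ℕ) 0 (1, 1)} else ∅
  | r + 1, s' => {s ∈ stateBox r | R r s s'}.biUnion
      fun s => (walks R r s).image fun f => Function.update f (r + 1) s'

variable {R : ℕ → ℕ × ℕ → ℕ × ℕ → Prop}

theorem IsWalk.mem_stateBox (hR : ∀ r s s', R r s s' → s' ∈ stateBox (r + 1))
    {N : ℕ} {f : ℕ → ℕ × ℕ} (hf : IsWalk R N f) : f N ∈ stateBox N := by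
  rcases N with _ | r
  · simp [hf.1, stateBox]
  · exact hR r _ _ (hf.2.1 r (Nat.lt_succ_self r))

theorem mem_walks (hR : ∀ r s s', R r s s' → s' ∈ stateBox (r + 1))
    {N : ℕ} {s : ℕ × ℕ} {f : ℕ → ℕ × ℕ} :
    f ∈ walks R N s ↔ IsWalk R N f ∧ f N = s := by
  induction N generalizing s f with
  | zero =>
    simp only [walks]
    constructor
    · split_ifs with h
      · intro hf
        rw [Finset.mem_singleton] at hf
        subst hf h
        refine ⟨⟨by simp, by simp, fun r hr => ?_⟩, by simp⟩
        rw [Function.update_of_ne (by omega)]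
        rfl
      · simp
    · rintro ⟨⟨h0, -, h2⟩, rfl⟩
      rw [if_pos h0, Finset.mem_singleton]
      funext r
      rcases Nat.eq_zero_or_pos r with rfl | hr
      · simpa using h0
      · rw [Function.update_of_ne (by omega), h2 r hr]
        rfl
  | succ N ih =>
    simp only [walks, mem_biUnion, mem_filter, mem_image]
    constructor
    · rintro ⟨s', ⟨-, hs'⟩, g, hg, rfl⟩
      obtain ⟨⟨h0, h1, h2⟩, h3⟩ := ih.1 hg
      refine ⟨⟨by simpa using h0, fun r hr => ?_, fun r hr => ?_⟩, by simp⟩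
      · rcases Nat.lt_succ_iff_lt_or_eq.1 hr with hr' | rfl
        · rw [Function.update_of_ne (by omega), Function.update_of_ne (by omega)]
          exact h1 r hr'
        · rw [Function.update_of_ne (by omega), Function.update_self, h3]
          exact hs'
      · rw [Function.update_of_ne (by omega)]
        exact h2 r (by omega)
    · rintro ⟨⟨h0, h1, h2⟩, rfl⟩
      have hg : IsWalk R N (Function.update f (N + 1) 0) := by
        refine ⟨by simpa using h0, fun r hr => ?_, fun r hr => ?_⟩
        · rw [Function.update_of_ne (by omega), Function.update_of_ne (by omega)]
          exact h1 r (by omega)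
        · by_cases hrN : r = N + 1
          · subst hrN
            simp
          · rw [Function.update_of_ne hrN]
            exact h2 r (by omega)
      have hN : Function.update f (N + 1) 0 N = f N := Function.update_of_ne (by omega) _ _
      refine ⟨f N, ⟨hN ▸ hg.mem_stateBox hR, h1 N (by omega)⟩, _, ih.2 ⟨hg, hN⟩, ?_⟩
      simp

theorem disjoint_walks (hR : ∀ r s s', R r s s' → s' ∈ stateBox (r + 1)) (N : ℕ) {s t : ℕ × ℕ}
    (hst : s ≠ t) : Disjoint (walks R N s) (walks R N t) := by
  rw [Finset.disjoint_left]
  intro f hf hf'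
  exact hst (((mem_walks hR).1 hf).2.symm.trans ((mem_walks hR).1 hf').2)

open Classical in
theorem card_walks_succ (hR : ∀ r s s', R r s s' → s' ∈ stateBox (r + 1)) (N : ℕ) (s' : ℕ × ℕ) :
    #(walks R (N + 1) s') = ∑ s ∈ stateBox N with R N s s', #(walks R N s) := by
  have key : ∀ {s f}, f ∈ walks R N s →
      Function.update (Function.update f (N + 1) s') (N + 1) 0 = f := by
    intro s f hf
    rw [Function.update_idem, Function.update_eq_self_iff]
    exact (((mem_walks hR).1 hf).1.2.2 _ (by omega)).symm
  rw [walks, card_biUnion]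
  · refine sum_congr rfl fun s _ => card_image_of_injOn fun f hf g hg hfg => ?_
    rw [← key hf, ← key hg]
    exact congrArg (Function.update · (N + 1) 0) hfg
  · intro s _ t _ hst
    rw [Function.onFun, Finset.disjoint_left]
    simp only [mem_image]
    rintro _ ⟨f, hf, rfl⟩ ⟨g, hg, hfg⟩
    have : f = g := by
      rw [← key hf, ← key hg]
      exact congrArg (Function.update · (N + 1) 0) hfg.symm
    subst this
    exact Finset.disjoint_left.1 (disjoint_walks hR N hst) hf hg

theorem ncard_walks (hR : ∀ r s s', R r s s' → s' ∈ stateBox (r + 1)) (N : ℕ)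
    (A : Finset (ℕ × ℕ)) :
    {f | IsWalk R N f ∧ f N ∈ A}.ncard = ∑ s ∈ A, #(walks R N s) := by
  classical
  rw [← card_biUnion fun s _ t _ hst => disjoint_walks hR N hst, ← Set.ncard_coe_finset]
  congr 1
  ext f
  simp [mem_walks hR]

end Walks

section Steps

open Finset

/-- Adding a row to a two-column Gog trapezoid. A state `(x, y)` records the lowest entry of the
first column and the lowest entry of the second column. -/
def GogStep (r : ℕ) (s s' : ℕ × ℕ) : Prop :=
  s.1 ≤ s'.1 ∧ s.2 ≤ s'.2 ∧ s'.1 ≤ s'.2 ∧ s'.2 ≤ r + 2 ∧ s.1 < s'.2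

/-- Adding a row to a two-column GOGAm trapezoid. -/
def GogamStep (r : ℕ) (s s' : ℕ × ℕ) : Prop :=
  s.1 ≤ s'.1 ∧ s.2 ≤ s'.2 ∧ s'.1 ≤ s'.2 ∧ s'.2 ≤ r + 2 ∧ (s'.2 = r + 2 → s.1 < s'.1)

theorem GogStep.mem_stateBox (r : ℕ) (s s' : ℕ × ℕ) (h : GogStep r s s') :
    s' ∈ stateBox (r + 1) := by
  obtain ⟨-, -, h1, h2, -⟩ := h
  simp only [stateBox, mem_product, mem_range]
  omega

theorem GogamStep.mem_stateBox (r : ℕ) (s s' : ℕ × ℕ) (h : GogamStep r s s') :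
    s' ∈ stateBox (r + 1) := by
  obtain ⟨-, -, h1, h2, -⟩ := h
  simp only [stateBox, mem_product, mem_range]
  omega

theorem IsWalk.bounds {R : ℕ → ℕ × ℕ → ℕ × ℕ → Prop}
    (hR : ∀ r s s', R r s s' → s.1 ≤ s'.1 ∧ s'.1 ≤ s'.2 ∧ s'.2 ≤ r + 2) {N : ℕ}
    {f : ℕ → ℕ × ℕ} (hf : IsWalk R N f) {r : ℕ} (hr : r ≤ N) :
    1 ≤ (f r).1 ∧ (f r).1 ≤ (f r).2 ∧ (f r).2 ≤ r + 1 := by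
  induction r with
  | zero => simp [hf.1]
  | succ r ih =>
    have := hR _ _ _ (hf.2.1 r (by omega))
    have := ih (by omega)
    omega

theorem GogStep.bounds (r : ℕ) (s s' : ℕ × ℕ) (h : GogStep r s s') :
    s.1 ≤ s'.1 ∧ s'.1 ≤ s'.2 ∧ s'.2 ≤ r + 2 :=
  ⟨h.1, h.2.2.1, h.2.2.2.1⟩

theorem GogamStep.bounds (r : ℕ) (s s' : ℕ × ℕ) (h : GogamStep r s s') :
    s.1 ≤ s'.1 ∧ s'.1 ≤ s'.2 ∧ s'.2 ≤ r + 2 :=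
  ⟨h.1, h.2.2.1, h.2.2.2.1⟩

/-- The number of Gog walks ending at `(x, y)`. -/
noncomputable def gogCount (r x y : ℕ) : ℕ := #(walks GogStep r (x, y))

/-- The number of GOGAm walks ending at `(x, y)`. -/
noncomputable def gogamCount (r x y : ℕ) : ℕ := #(walks GogamStep r (x, y))

theorem gogCount_eq_zero {r x y : ℕ} (h : ¬ (1 ≤ x ∧ x ≤ y ∧ y ≤ r + 1)) :
    gogCount r x y = 0 := by
  rw [gogCount, card_eq_zero, eq_empty_iff_forall_notMem]
  intro f hf
  obtain ⟨hw, he⟩ := (mem_walks GogStep.mem_stateBox).1 hf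
  have := hw.bounds GogStep.bounds le_rfl
  rw [he] at this
  exact h this

theorem gogamCount_eq_zero {r x y : ℕ} (h : ¬ (1 ≤ x ∧ x ≤ y ∧ y ≤ r + 1)) :
    gogamCount r x y = 0 := by
  rw [gogamCount, card_eq_zero, eq_empty_iff_forall_notMem]
  intro f hf
  obtain ⟨hw, he⟩ := (mem_walks GogamStep.mem_stateBox).1 hf
  have := hw.bounds GogamStep.bounds le_rfl
  rw [he] at this
  exact h this

/-- The sum of `F` over `{0, …, p} × {0, …, q}`. -/
def cumul (F : ℕ → ℕ → ℕ) (p q : ℕ) : ℕ :=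
  ∑ a ∈ range (p + 1), ∑ b ∈ range (q + 1), F a b

theorem sum_stateBox_filter {F : ℕ → ℕ → ℕ} {r : ℕ}
    (hF : ∀ a b, ¬ (1 ≤ a ∧ a ≤ b ∧ b ≤ r + 1) → F a b = 0) {P : ℕ × ℕ → Prop}
    [DecidablePred P] {p q : ℕ}
    (hP : ∀ a b, 1 ≤ a → a ≤ b → b ≤ r + 1 → (P (a, b) ↔ a ≤ p ∧ b ≤ q)) :
    ∑ s ∈ stateBox r with P s, F s.1 s.2 = cumul F p q := by
  rw [cumul, ← sum_product']
  refine sum_congr_of_eq_on_inter ?_ ?_ fun _ _ _ => rfl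
  all_goals
    rintro ⟨a, b⟩ h1 h2
    by_cases hab : 1 ≤ a ∧ a ≤ b ∧ b ≤ r + 1
    · have := hP a b hab.1 hab.2.1 hab.2.2
      simp only [stateBox, mem_filter, mem_product, mem_range, this] at h1 h2
      omega
    · exact hF a b hab

theorem gogCount_succ_of_lt {r x y : ℕ} (hxy : x < y) (hy : y ≤ r + 2) :
    gogCount (r + 1) x y = cumul (gogCount r) x y := by
  classical
  rw [gogCount, card_walks_succ GogStep.mem_stateBox]
  refine sum_stateBox_filter (F := gogCount r) (fun _ _ => gogCount_eq_zero) fun a b _ _ _ => ?_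
  simp only [GogStep]
  omega

theorem gogCount_succ_self {r x : ℕ} (hx : x + 1 ≤ r + 2) :
    gogCount (r + 1) (x + 1) (x + 1) = cumul (gogCount r) x (x + 1) := by
  classical
  rw [gogCount, card_walks_succ GogStep.mem_stateBox]
  refine sum_stateBox_filter (F := gogCount r) (fun _ _ => gogCount_eq_zero) fun a b _ _ _ => ?_
  simp only [GogStep]
  omega

theorem gogamCount_succ_of_le {r x y : ℕ} (hxy : x ≤ y) (hy : y ≤ r + 1) :
    gogamCount (r + 1) x y = cumul (gogamCount r) x y := by
  classical
  rw [gogamCount, card_walks_succ GogamStep.mem_stateBox]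
  refine sum_stateBox_filter (F := gogamCount r) (fun _ _ => gogamCount_eq_zero)
    fun a b _ _ _ => ?_
  simp only [GogamStep]
  omega

theorem gogamCount_succ_top {r x : ℕ} (hx : x ≤ r + 1) :
    gogamCount (r + 1) (x + 1) (r + 2) = cumul (gogamCount r) x (r + 2) := by
  classical
  rw [gogamCount, card_walks_succ GogamStep.mem_stateBox]
  refine sum_stateBox_filter (F := gogamCount r) (fun _ _ => gogamCount_eq_zero)
    fun a b _ _ _ => ?_
  simp only [GogamStep, forall_const]
  omega

theorem cumul_succ_left (F : ℕ → ℕ → ℕ) (p q : ℕ) :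
    cumul F (p + 1) q = cumul F p q + ∑ b ∈ range (q + 1), F (p + 1) b := by
  rw [cumul, sum_range_succ, cumul]

theorem cumul_succ_right (F : ℕ → ℕ → ℕ) (p q : ℕ) :
    cumul F p (q + 1) = cumul F p q + ∑ a ∈ range (p + 1), F a (q + 1) := by
  simp only [cumul, sum_range_succ _ (q + 1), sum_add_distrib]

theorem cumul_zero_left {F : ℕ → ℕ → ℕ} (hF : ∀ b, F 0 b = 0) (q : ℕ) : cumul F 0 q = 0 := by
  simp [cumul, hF]

theorem cumul_gogamCount_of_sum {r : ℕ}
    (h : ∀ x y, x + 1 ≤ y → ∑ b ∈ range (y + 1), gogamCount r (x + 1) b + gogCount r x (y + 1) =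
      ∑ b ∈ range (y + 1 + 1), gogCount r (x + 1) b) {x y : ℕ} (hxy : x + 1 ≤ y) :
    cumul (gogamCount r) (x + 1) y + cumul (gogCount r) x (y + 1) =
      cumul (gogCount r) (x + 1) (y + 1) + cumul (gogCount r) x y := by
  induction x with
  | zero =>
    have := h 0 y hxy
    simp only [cumul_succ_left, cumul_zero_left fun b => gogCount_eq_zero (r := r) (x := 0) (y := b)
      (by omega), cumul_zero_left fun b => gogamCount_eq_zero (r := r) (x := 0) (y := b)
      (by omega)]
    rw [gogCount_eq_zero (x := 0) (by omega)] at this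
    omega
  | succ x ih =>
    have h1 := ih (by omega)
    have h2 := h (x + 1) y hxy
    have h3 := cumul_succ_right (gogCount r) x y
    have h4 := cumul_succ_right (gogCount r) (x + 1) y
    rw [sum_range_succ] at h4
    rw [cumul_succ_left (gogamCount r) (x + 1), cumul_succ_left (gogCount r) (x + 1) (y + 1)]
    omega

theorem cumul_gogCount_top (r x : ℕ) {y : ℕ} (hy : r + 1 ≤ y) :
    cumul (gogCount r) x (y + 1) = cumul (gogCount r) x y := by
  rw [cumul_succ_right, sum_eq_zero, add_zero]
  intro a _
  exact gogCount_eq_zero (by omega)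

theorem sum_gogamCount_add (r x y : ℕ) (hxy : x + 1 ≤ y) :
    ∑ b ∈ range (y + 1), gogamCount r (x + 1) b + gogCount r x (y + 1) =
      ∑ b ∈ range (y + 1 + 1), gogCount r (x + 1) b := by
  induction r generalizing x y with
  | zero =>
    rw [gogCount_eq_zero (y := y + 1) (by omega), sum_range_succ _ (y + 1),
      gogCount_eq_zero (y := y + 1) (by omega)]
    refine congrArg (· + 0) (sum_congr rfl fun b _ => ?_)
    simp [gogCount, gogamCount, walks]
  | succ r ih =>
    have hL := fun {x y : ℕ} => cumul_gogamCount_of_sum ih (x := x) (y := y)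
    have htop : ∀ z, z ≤ r + 1 →
        cumul (gogamCount r) z (r + 2) = cumul (gogCount r) z (r + 2) := by
      rintro (_ | z) hz
      · rw [cumul_zero_left fun b => gogCount_eq_zero (by omega),
          cumul_zero_left fun b => gogamCount_eq_zero (by omega)]
      · have := hL (x := z) (y := r + 2) (by omega)
        rw [cumul_gogCount_top r z (by omega), cumul_gogCount_top r (z + 1) (by omega)] at this
        omega
    induction y, hxy using Nat.le_induction with
    | base =>
      rw [sum_range_succ _ (x + 1), sum_range_succ _ (x + 1 + 1), sum_range_succ _ (x + 1),
        sum_eq_zero fun b hb => gogamCount_eq_zero (by rw [mem_range] at hb; omega),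
        sum_eq_zero fun b hb => gogCount_eq_zero (by rw [mem_range] at hb; omega)]
      rcases lt_trichotomy x (r + 1) with hx | rfl | hx
      · rw [gogCount_succ_of_lt (x := x) (by omega) (by omega),
          gogCount_succ_self (by omega), gogCount_succ_of_lt (by omega) (by omega),
          gogamCount_succ_of_le (by omega) (by omega)]
        have := hL (x := x) (y := x + 1) le_rfl
        omega
      · rw [gogCount_eq_zero (y := r + 1 + 1 + 1) (by omega),
          gogCount_eq_zero (y := r + 1 + 1 + 1) (by omega), gogCount_succ_self (by omega),
          gogamCount_succ_top (by omega), htop _ le_rfl]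
      · rw [gogCount_eq_zero (by omega), gogCount_eq_zero (by omega), gogCount_eq_zero (by omega),
          gogamCount_eq_zero (by omega)]
    | succ y hy ih' =>
      rw [sum_range_succ _ (y + 1), sum_range_succ _ (y + 1 + 1)]
      rcases lt_trichotomy (y + 1) (r + 2) with hr | hr | hr
      · rw [gogCount_succ_of_lt (by omega) (by omega)] at ih' ⊢
        rw [gogCount_succ_of_lt (x := x + 1) (by omega) (by omega),
          gogamCount_succ_of_le (by omega) (by omega)]
        have := hL (x := x) (y := y + 1) (by omega)
        omega
      · rw [gogCount_succ_of_lt (by omega) (by omega)] at ih'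
        rw [gogCount_eq_zero (y := y + 1 + 1) (by omega),
          gogCount_eq_zero (y := y + 1 + 1) (by omega), hr, gogamCount_succ_top (by omega),
          htop _ (by omega)]
        rw [show y = r + 1 by omega] at ih'
        exact ih'
      · rw [gogCount_eq_zero (y := y + 1) (by omega)] at ih'
        rw [gogCount_eq_zero (y := y + 1 + 1) (by omega),
          gogCount_eq_zero (y := y + 1 + 1) (by omega), gogamCount_eq_zero (by omega)]
        omega

theorem sum_gogCount_eq_sum_gogamCount (r x : ℕ) :
    ∑ y ∈ range (r + 2), gogCount r x y = ∑ y ∈ range (r + 2), gogamCount r x y := by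
  by_cases hx : 1 ≤ x ∧ x ≤ r + 1
  · obtain ⟨x, rfl⟩ := Nat.exists_eq_add_of_le' hx.1
    have := sum_gogamCount_add r x (r + 1) hx.2
    rw [sum_range_succ _ (r + 1 + 1), gogCount_eq_zero (y := r + 1 + 1) (by omega),
      gogCount_eq_zero (y := r + 1 + 1) (by omega)] at this
    exact this.symm
  · refine sum_congr rfl fun y _ => ?_
    rw [gogCount_eq_zero (by omega), gogamCount_eq_zero (by omega)]

end Steps

section Trapezoids

/-- The two-column trapezoid of size `n` read off from a sequence of states. -/
def toTrapezoid (n : ℕ) (f : ℕ → ℕ × ℕ) (i j : ℕ) : ℤ :=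
  if 1 ≤ j ∧ j ≤ i ∧ i ≤ n ∧ j ≤ 2 then
    if j = 1 then ((f (n - i)).1 : ℤ) else ((f (n - i + 1)).2 : ℤ)
  else 0

theorem toTrapezoid_one {n i : ℕ} (f : ℕ → ℕ × ℕ) (h1 : 1 ≤ i) (hi : i ≤ n) :
    toTrapezoid n f i 1 = (f (n - i)).1 := by
  rw [toTrapezoid, if_pos (by omega), if_pos rfl]

theorem toTrapezoid_two {n i : ℕ} (f : ℕ → ℕ × ℕ) (h2 : 2 ≤ i) (hi : i ≤ n) :
    toTrapezoid n f i 2 = (f (n - i + 1)).2 := by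
  rw [toTrapezoid, if_pos (by omega), if_neg (by omega)]

theorem toTrapezoid_of_not_leftIdx {n i j : ℕ} (f : ℕ → ℕ × ℕ) (h : ¬ LeftIdx n 2 i j) :
    toTrapezoid n f i j = 0 :=
  if_neg h

theorem injOn_toTrapezoid (R : ℕ → ℕ × ℕ → ℕ × ℕ → Prop) (N : ℕ) :
    Set.InjOn (toTrapezoid (N + 1)) {f | IsWalk R N f} := by
  intro f hf g hg hfg
  funext r
  rcases Nat.eq_zero_or_pos r with rfl | hr
  · rw [hf.1, hg.1]
  by_cases hrN : N < r
  · rw [hf.2.2 r hrN, hg.2.2 r hrN]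
  have h1 := congrFun (congrFun hfg (N + 1 - r)) 1
  have h2 := congrFun (congrFun hfg (N + 1 - r + 1)) 2
  rw [toTrapezoid_one _ (by omega) (by omega), toTrapezoid_one _ (by omega) (by omega),
    show N + 1 - (N + 1 - r) = r by omega] at h1
  rw [toTrapezoid_two _ (by omega) (by omega), toTrapezoid_two _ (by omega) (by omega),
    show N + 1 - (N + 1 - r + 1) + 1 = r by omega] at h2
  exact Prod.ext (by exact_mod_cast h1) (by exact_mod_cast h2)

/-- The conditions shared by the two-column Gog and GOGAm trapezoids of size `n`. -/
structure IsTwoColumn (n : ℕ) (X : ℕ → ℕ → ℤ) : Prop where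
  eq_zero : ∀ i j, ¬ LeftIdx n 2 i j → X i j = 0
  top : X n 1 = 1
  pos : ∀ i, 1 ≤ i → i ≤ n → 1 ≤ X i 1
  left : ∀ i, 1 ≤ i → i < n → X (i + 1) 1 ≤ X i 1
  diag : ∀ i, 1 ≤ i → i < n → X i 1 ≤ X (i + 1) 2
  right : ∀ i, 2 ≤ i → i < n → X (i + 1) 2 ≤ X i 2
  le : ∀ i, 1 ≤ i → i < n → X (i + 1) 2 ≤ n - i + 1

/-- The sequence of states of a two-column trapezoid. -/
def ofTrapezoid (n : ℕ) (X : ℕ → ℕ → ℤ) (r : ℕ) : ℕ × ℕ :=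
  if r = 0 then (1, 1) else if r < n then ((X (n - r) 1).toNat, (X (n - r + 1) 2).toNat) else 0

theorem IsTwoColumn.two_pos {n : ℕ} {X : ℕ → ℕ → ℤ} (hX : IsTwoColumn n X) {i : ℕ} (h2 : 2 ≤ i)
    (hi : i ≤ n) : 1 ≤ X i 2 := by
  obtain ⟨i, rfl⟩ := Nat.exists_eq_add_of_le' (show 1 ≤ i by omega)
  exact (hX.pos i (by omega) (by omega)).trans (hX.diag i (by omega) (by omega))

theorem IsTwoColumn.ofTrapezoid_fst {n : ℕ} {X : ℕ → ℕ → ℤ} (hX : IsTwoColumn n X) {r : ℕ}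
    (hr : r < n) : ((ofTrapezoid n X r).1 : ℤ) = X (n - r) 1 := by
  rw [ofTrapezoid]
  split_ifs with h
  · simp [h, hX.top]
  · exact Int.toNat_of_nonneg (by linarith [hX.pos (n - r) (by omega) (by omega)])

theorem IsTwoColumn.ofTrapezoid_snd {n : ℕ} {X : ℕ → ℕ → ℤ} (hX : IsTwoColumn n X) {r : ℕ}
    (h1 : 1 ≤ r) (hr : r < n) : ((ofTrapezoid n X r).2 : ℤ) = X (n - r + 1) 2 := by
  rw [ofTrapezoid, if_neg (by omega), if_pos hr]
  exact Int.toNat_of_nonneg (by linarith [hX.two_pos (i := n - r + 1) (by omega) (by omega)])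

theorem IsTwoColumn.toTrapezoid_ofTrapezoid {n : ℕ} {X : ℕ → ℕ → ℤ} (hX : IsTwoColumn n X) :
    toTrapezoid n (ofTrapezoid n X) = X := by
  funext i j
  by_cases h : LeftIdx n 2 i j
  · obtain ⟨h1, h2, h3, h4⟩ := h
    interval_cases j
    · rw [toTrapezoid_one _ h2 h3, hX.ofTrapezoid_fst (by omega),
        show n - (n - i) = i by omega]
    · rw [toTrapezoid_two _ h2 h3, hX.ofTrapezoid_snd (by omega) (by omega),
        show n - (n - i + 1) + 1 = i by omega]
  · rw [toTrapezoid_of_not_leftIdx _ h, hX.eq_zero i j h]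

theorem image_toTrapezoid {n : ℕ} (hn : 2 ≤ n) {R : ℕ → ℕ × ℕ → ℕ × ℕ → Prop}
    {Q : ℕ → ℤ → ℤ → ℤ → Prop}
    (hR : ∀ r s s', R r s s' ↔
      (s.1 ≤ s'.1 ∧ s.2 ≤ s'.2 ∧ s'.1 ≤ s'.2 ∧ s'.2 ≤ r + 2) ∧ Q r s.1 s'.1 s'.2) :
    toTrapezoid n '' {f | IsWalk R (n - 1) f} =
      {X | IsTwoColumn n X ∧
        ∀ i, 1 ≤ i → i < n → Q (n - 1 - i) (X (i + 1) 1) (X i 1) (X (i + 1) 2)} := by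
  ext X
  constructor
  · rintro ⟨f, hf, rfl⟩
    have hstep : ∀ i, 1 ≤ i → i < n → R (n - 1 - i) (f (n - (i + 1))) (f (n - i)) := by
      intro i h1 hi
      have := hf.2.1 (n - 1 - i) (by omega)
      rwa [show n - 1 - i + 1 = n - i by omega,
        congrArg f (show n - 1 - i = n - (i + 1) by omega)] at this
    have htwo : ∀ i, 1 ≤ i → i < n → toTrapezoid n f (i + 1) 2 = (f (n - i)).2 := by
      intro i h1 hi
      rw [toTrapezoid_two _ (by omega) (by omega), show n - (i + 1) + 1 = n - i by omega]
    refine ⟨⟨fun i j => toTrapezoid_of_not_leftIdx f, ?_, fun i h1 hi => ?_, fun i h1 hi => ?_,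
      fun i h1 hi => ?_, fun i h2 hi => ?_, fun i h1 hi => ?_⟩, fun i h1 hi => ?_⟩
    · rw [toTrapezoid_one _ (by omega) le_rfl, Nat.sub_self, hf.1]
      rfl
    · rw [toTrapezoid_one _ h1 hi]
      have := hf.bounds (r := n - i)
        (fun r s s' h => ⟨((hR r s s').1 h).1.1, ((hR r s s').1 h).1.2.2⟩) (by omega)
      omega
    · have := ((hR _ _ _).1 (hstep i h1 hi)).1
      rw [toTrapezoid_one _ (by omega) (by omega), toTrapezoid_one _ (by omega) (by omega)]
      omega
    · have := ((hR _ _ _).1 (hstep i h1 hi)).1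
      rw [toTrapezoid_one _ (by omega) (by omega), htwo i h1 hi]
      omega
    · obtain ⟨i, rfl⟩ := Nat.exists_eq_add_of_le' (show 1 ≤ i by omega)
      have := ((hR _ _ _).1 (hstep i (by omega) (by omega))).1
      rw [htwo _ (by omega) hi, htwo _ (by omega) (by omega)]
      omega
    · have := ((hR _ _ _).1 (hstep i h1 hi)).1
      rw [htwo i h1 hi]
      omega
    · have := ((hR _ _ _).1 (hstep i h1 hi)).2
      rwa [toTrapezoid_one _ (by omega) (by omega), toTrapezoid_one _ (by omega) (by omega),
        htwo i h1 hi]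
  · rintro ⟨hX, hQ⟩
    refine ⟨ofTrapezoid n X, ⟨if_pos rfl, fun r hr => (hR _ _ _).2 ?_, fun r hr => ?_⟩,
      hX.toTrapezoid_ofTrapezoid⟩
    · obtain ⟨i, h1, hi, rfl⟩ : ∃ i, 1 ≤ i ∧ i < n ∧ r = n - 1 - i :=
        ⟨n - 1 - r, by omega, by omega, by omega⟩
      have e1 := hX.ofTrapezoid_fst (r := n - 1 - i) (by omega)
      have e2 := hX.ofTrapezoid_fst (r := n - 1 - i + 1) (by omega)
      have e3 := hX.ofTrapezoid_snd (r := n - 1 - i + 1) (by omega) (by omega)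
      have e4 : ((ofTrapezoid n X (n - 1 - i)).2 : ℤ) ≤ X (i + 1) 2 := by
        rcases Nat.eq_zero_or_pos (n - 1 - i) with h | h
        · rw [h]
          exact hX.two_pos (by omega) (by omega)
        · rw [hX.ofTrapezoid_snd h (by omega), show n - (n - 1 - i) + 1 = i + 1 + 1 by omega]
          exact hX.right (i + 1) (by omega) (by omega)
      rw [show n - (n - 1 - i) = i + 1 by omega] at e1
      rw [show n - (n - 1 - i + 1) = i by omega] at e2 e3
      have := hX.left i h1 hi
      have := hX.diag i h1 hi
      have := hX.le i h1 hi
      refine ⟨by omega, ?_⟩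
      rw [e1, e2, e3]
      exact hQ i h1 hi
    · rw [ofTrapezoid, if_neg (by omega), if_neg (by omega)]

theorem IsGT.le_diag {n : ℕ} {X : ℕ → ℕ → ℤ} (hX : IsGT n X) {i j : ℕ} (hj : 1 ≤ j) (hji : j ≤ i)
    (t : ℕ) (ht : i + t ≤ n) : X i j ≤ X (i + t) (j + t) := by
  induction t with
  | zero => exact le_rfl
  | succ t ih => exact (ih (by omega)).trans (hX.2 (i + t) (j + t) (by omega) (by omega) ht).2

theorem leftGogTrapezoids_two {n : ℕ} (hn : 2 ≤ n) :
    LeftGogTrapezoids n 2 =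
      {X | IsTwoColumn n X ∧ ∀ i, 1 ≤ i → i < n → X (i + 1) 1 < X (i + 1) 2} := by
  ext X
  constructor
  · rintro ⟨⟨Y, ⟨hGT, hrow, htop⟩, hXY⟩, h0⟩
    have e1 : ∀ i, 1 ≤ i → i ≤ n → X i 1 = Y i 1 := fun i h1 hi =>
      hXY i 1 ⟨le_rfl, h1, hi, one_le_two⟩
    have e2 : ∀ i, 2 ≤ i → i ≤ n → X i 2 = Y i 2 := fun i h1 hi =>
      hXY i 2 ⟨one_le_two, h1, hi, le_rfl⟩
    refine ⟨⟨h0, ?_, fun i h1 hi => ?_, fun i h1 hi => ?_, fun i h1 hi => ?_, fun i h2 hi => ?_,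
      fun i h1 hi => ?_⟩, fun i h1 hi => ?_⟩
    · rw [e1 n (by omega) le_rfl]
      exact htop 1 le_rfl (by omega)
    · rw [e1 i h1 hi]
      exact hGT.1 i 1 le_rfl h1 hi
    · rw [e1 _ (by omega) (by omega), e1 i h1 (by omega)]
      exact (hGT.2 i 1 le_rfl h1 hi).1
    · rw [e1 _ (by omega) (by omega), e2 _ (by omega) (by omega)]
      exact (hGT.2 i 1 le_rfl h1 hi).2
    · rw [e2 _ (by omega) (by omega), e2 _ (by omega) (by omega)]
      exact (hGT.2 i 2 (by omega) h2 hi).1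
    · rw [e2 _ (by omega) (by omega)]
      have := hGT.le_diag (i := i + 1) (j := 2) (by omega) (by omega) (n - (i + 1)) (by omega)
      rw [show i + 1 + (n - (i + 1)) = n by omega, htop _ (by omega) (by omega)] at this
      omega
    · rw [e1 _ (by omega) (by omega), e2 _ (by omega) (by omega)]
      exact hrow (i + 1) 1 le_rfl (by omega) hi
  · rintro ⟨hX, hlt⟩
    have hle1 : ∀ i, 1 ≤ i → i ≤ n → X i 1 ≤ n - i + 1 := by
      intro i h1 hi
      rcases hi.lt_or_eq with hi | rfl
      · exact (hX.diag i h1 hi).trans (hX.le i h1 hi)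
      · simp [hX.top]
    have hle2 : ∀ i, 2 ≤ i → i ≤ n → X i 2 ≤ n - i + 2 := by
      intro i h1 hi
      obtain ⟨i, rfl⟩ := Nat.exists_eq_add_of_le' (show 1 ≤ i by omega)
      have := hX.le i (by omega) (by omega)
      push_cast
      linarith
    have hlt' : ∀ i, 2 ≤ i → i ≤ n → X i 1 < X i 2 := by
      intro i h1 hi
      obtain ⟨i, rfl⟩ := Nat.exists_eq_add_of_le' (show 1 ≤ i by omega)
      exact hlt i (by omega) (by omega)
    refine ⟨⟨fun i j => if j ≤ 2 then X i j else n - i + j,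
      ⟨⟨fun i j h1 hji hi => ?_, fun i j h1 hji hi => ?_⟩, fun i j h1 hji hi => ?_,
        fun j h1 hj => ?_⟩, fun i j hij => ?_⟩, hX.eq_zero⟩ <;> dsimp only
    · split_ifs with h
      · interval_cases j
        · exact hX.pos i hji hi
        · exact hX.two_pos hji hi
      · omega
    · obtain rfl | rfl | h3 : j = 1 ∨ j = 2 ∨ 3 ≤ j := by omega
      · simpa using ⟨hX.left i hji hi, hX.diag i hji hi⟩
      · have := hX.right i hji hi
        have := hle2 i hji (by omega)
        simp only [le_refl, if_true, show ¬ (2 + 1 ≤ 2) by omega, if_false]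
        push_cast
        constructor <;> linarith
      · rw [if_neg (by omega), if_neg (by omega), if_neg (by omega)]
        push_cast
        constructor <;> linarith
    · obtain rfl | rfl | h3 : j = 1 ∨ j = 2 ∨ 3 ≤ j := by omega
      · simpa using hlt' i hji hi
      · have := hle2 i (by omega) (by omega)
        simp only [le_refl, if_true, show ¬ (2 + 1 ≤ 2) by omega, if_false]
        push_cast
        linarith
      · rw [if_neg (by omega), if_neg (by omega)]
        push_cast
        linarith
    · split_ifs with h
      · interval_cases j
        · exact hX.top
        · have h1 := hlt' n hn le_rfl
          have h2 := hle2 n hn le_rfl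
          rw [hX.top] at h1
          push_cast
          omega
      · omega
    · rw [if_pos hij.2.2.2]

theorem IsGogam.le_of_seq {n : ℕ} {Y : ℕ → ℕ → ℤ} (hY : IsGogam n Y) {m c : ℕ} (hc : 1 ≤ c)
    (hm : 1 ≤ m) (hmn : m + c ≤ n) :
    Y (n - m + 1 + (m - 1)) (n - m + 1) - Y (c + (m - 1)) c + Y (c + m) c ≤ n - m := by
  obtain ⟨m, rfl⟩ := Nat.exists_eq_add_of_le' hm
  have h := hY.2.2 (n - (m + 1)) (by omega) (by omega) (fun i => if i < m + 1 then n - i else c)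
    (by simp) (fun i hi => ?_) ?_
  · rw [show n - (n - (m + 1)) = m + 1 by omega, Finset.sum_range_succ] at h
    simp only [lt_irrefl, if_false, Nat.lt_succ_self, if_true] at h
    have hnonneg : 0 ≤ ∑ i ∈ Finset.range m,
        (Y ((if i < m + 1 then n - i else c) + i) (if i < m + 1 then n - i else c) -
          Y ((if i + 1 < m + 1 then n - (i + 1) else c) + i)
            (if i + 1 < m + 1 then n - (i + 1) else c)) := by
      refine Finset.sum_nonneg fun i hi => ?_
      rw [Finset.mem_range] at hi
      rw [if_pos (by omega), if_pos (by omega), sub_nonneg]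
      have := (hY.1.2 (n - (i + 1) + i) (n - (i + 1)) (by omega) (by omega) (by omega)).2
      rwa [show n - (i + 1) + i + 1 = n - i + i by omega,
        show n - (i + 1) + 1 = n - i by omega] at this
    rw [show n - (m + 1) + 1 = n - m by omega, Nat.add_sub_cancel]
    omega
  · split_ifs <;> omega
  · split_ifs <;> omega

theorem leftGogamTrapezoids_two {n : ℕ} (hn : 2 ≤ n) :
    LeftGogamTrapezoids n 2 =
      {X | IsTwoColumn n X ∧ ∀ i, 1 ≤ i → i < n →
        X (i + 1) 2 = ((n - 1 - i : ℕ) : ℤ) + 2 → X (i + 1) 1 < X i 1} := by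
  ext X
  constructor
  · rintro ⟨⟨Y, hY, hXY⟩, h0⟩
    have hGT := hY.1
    have e1 : ∀ i, 1 ≤ i → i ≤ n → X i 1 = Y i 1 := fun i h1 hi =>
      hXY i 1 ⟨le_rfl, h1, hi, one_le_two⟩
    have e2 : ∀ i, 2 ≤ i → i ≤ n → X i 2 = Y i 2 := fun i h1 hi =>
      hXY i 2 ⟨one_le_two, h1, hi, le_rfl⟩
    have hdiag : ∀ i, 2 ≤ i → i ≤ n → Y i 2 ≤ Y n (n - i + 2) := by
      intro i h2 hi
      have := hGT.le_diag (i := i) (j := 2) (by omega) h2 (n - i) (by omega)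
      rwa [show i + (n - i) = n by omega, add_comm 2] at this
    have hone : ∀ i, 1 ≤ i → i < n → Y (i + 1) 2 - Y i 1 + Y (i + 1) 1 ≤ n - i := by
      intro i h1 hi
      have h := hY.le_of_seq (m := i) (c := 1) le_rfl h1 (by omega)
      have := hdiag (i + 1) (by omega) (by omega)
      rw [show n - i + 1 + (i - 1) = n by omega, show 1 + (i - 1) = i by omega,
        add_comm 1 i] at h
      rw [show n - (i + 1) + 2 = n - i + 1 by omega] at this
      linarith
    have htop : Y n 1 = 1 := by
      obtain ⟨n, rfl⟩ := Nat.exists_eq_add_of_le' (show 1 ≤ n by omega)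
      have h1 := hone n (by omega) (by omega)
      have h2 := (hGT.2 n 1 le_rfl (by omega) le_rfl).2
      have h3 := hGT.1 (n + 1) 1 le_rfl (by omega) le_rfl
      push_cast at h1
      norm_num at h2
      linarith
    refine ⟨⟨h0, ?_, fun i h1 hi => ?_, fun i h1 hi => ?_, fun i h1 hi => ?_, fun i h2 hi => ?_,
      fun i h1 hi => ?_⟩, fun i h1 hi heq => ?_⟩
    · rw [e1 n (by omega) le_rfl, htop]
    · rw [e1 i h1 hi]
      exact hGT.1 i 1 le_rfl h1 hi
    · rw [e1 _ (by omega) (by omega), e1 i h1 (by omega)]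
      exact (hGT.2 i 1 le_rfl h1 hi).1
    · rw [e1 _ (by omega) (by omega), e2 _ (by omega) (by omega)]
      exact (hGT.2 i 1 le_rfl h1 hi).2
    · rw [e2 _ (by omega) (by omega), e2 _ (by omega) (by omega)]
      exact (hGT.2 i 2 (by omega) h2 hi).1
    · rw [e2 _ (by omega) (by omega)]
      rcases h1.eq_or_lt with rfl | h2
      · have := hdiag 2 le_rfl hn
        rw [show n - 2 + 2 = n by omega] at this
        have := hY.2.1
        push_cast
        norm_num
        linarith
      · have h := hY.le_of_seq (m := i - 1) (c := 2) (by omega) (by omega) (by omega)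
        have := hdiag i (by omega) (by omega)
        rw [show n - (i - 1) + 1 + (i - 1 - 1) = n by omega, show 2 + (i - 1 - 1) = i by omega,
          show 2 + (i - 1) = i + 1 by omega, show n - (i - 1) + 1 = n - i + 2 by omega] at h
        omega
    · rw [e2 _ (by omega) (by omega)] at heq
      rw [e1 _ (by omega) (by omega), e1 _ (by omega) (by omega)]
      have := hone i h1 hi
      omega
  · rintro ⟨hX, hlt⟩
    have htwo : ∀ i j, 2 ≤ j → (if j = 1 then X i 1 else X (i - j + 2) 2) = X (i - j + 2) 2 :=
      fun i j hj => if_neg (by omega)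
    refine ⟨⟨fun i j => if j = 1 then X i 1 else X (i - j + 2) 2,
      ⟨⟨fun i j h1 hji hi => ?_, fun i j h1 hji hi => ?_⟩, ?_, ?_⟩, fun i j hij => ?_⟩,
      hX.eq_zero⟩
    · dsimp only
      split_ifs with h
      · exact hX.pos i (by omega) hi
      · exact hX.two_pos (by omega) (by omega)
    · dsimp only
      rw [htwo (i + 1) (j + 1) (by omega), show i + 1 - (j + 1) + 2 = i - j + 2 by omega]
      split_ifs with h
      · subst h
        refine ⟨hX.left i hji hi, ?_⟩
        rw [show i - 1 + 2 = i + 1 by omega]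
        exact hX.diag i hji hi
      · refine ⟨?_, le_rfl⟩
        rw [show i + 1 - j + 2 = i - j + 2 + 1 by omega]
        exact hX.right _ (by omega) (by omega)
    · dsimp only
      rw [htwo n n hn, show n - n + 2 = 1 + 1 by omega]
      have := hX.le 1 le_rfl (by omega)
      push_cast at this
      linarith
    · intro k h1 hk j j0 hj hjm
      dsimp only
      obtain ⟨m, hm⟩ := Nat.exists_eq_add_of_le' (show 1 ≤ n - k by omega)
      rw [hm] at hj hjm ⊢
      have hlow : ∀ t, t ≤ m + 1 → t + 1 ≤ j (m + 1 - t) := by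
        intro t ht
        induction t with
        | zero => simpa using hjm
        | succ t ih =>
          have h := hj (m + 1 - (t + 1)) (by omega)
          rw [show m + 1 - (t + 1) + 1 = m + 1 - t by omega] at h
          have := ih (by omega)
          omega
      have hupp : ∀ i, i ≤ m + 1 → j i + i ≤ n := by
        intro i hi
        induction i with
        | zero => omega
        | succ i ih =>
          have := hj i (by omega)
          have := ih (by omega)
          omega
      have hge2 : ∀ i, i ≤ m → 2 ≤ j i := by
        intro i hi
        have := hlow (m + 1 - i) (by omega)
        rw [show m + 1 - (m + 1 - i) = i by omega] at this
        omega
      rw [Finset.sum_range_succ, Finset.sum_eq_zero, zero_add]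
      · rw [htwo _ _ (hge2 m le_rfl), show j m + m - j m + 2 = m + 1 + 1 by omega]
        have hle := hX.le (m + 1) (by omega) (by omega)
        split_ifs with h
        · rw [h, show 1 + m = m + 1 by omega, show 1 + (m + 1) = m + 1 + 1 by omega]
          have h1 := hlt (m + 1) (by omega) (by omega)
          have h2 := hX.left (m + 1) (by omega) (by omega)
          omega
        · have := hupp (m + 1) le_rfl
          rw [show j (m + 1) + m - j (m + 1) + 2 = m + 1 + 1 by omega,
            show j (m + 1) + (m + 1) - j (m + 1) + 2 = m + 1 + 1 + 1 by omega]
          have := hX.le (m + 1 + 1) (by omega) (by omega)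
          omega
      · intro i hi
        rw [Finset.mem_range] at hi
        rw [htwo _ _ (hge2 i (by omega)), htwo _ _ (hge2 (i + 1) (by omega)),
          Nat.add_sub_cancel_left, Nat.add_sub_cancel_left, sub_self]
    · obtain ⟨h1, h2, h3, h4⟩ := hij
      interval_cases j
      · simp
      · dsimp only
        rw [htwo i 2 le_rfl, show i - 2 + 2 = i by omega]

theorem leftGogTrapezoids_eq_image {n : ℕ} (hn : 2 ≤ n) :
    LeftGogTrapezoids n 2 = toTrapezoid n '' {f | IsWalk GogStep (n - 1) f} := by
  rw [leftGogTrapezoids_two hn]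
  refine (image_toTrapezoid hn (Q := fun _ x _ y' => x < y') fun r s s' => ?_).symm
  simp only [GogStep, Nat.cast_lt]
  tauto

theorem leftGogamTrapezoids_eq_image {n : ℕ} (hn : 2 ≤ n) :
    LeftGogamTrapezoids n 2 = toTrapezoid n '' {f | IsWalk GogamStep (n - 1) f} := by
  rw [leftGogamTrapezoids_two hn]
  refine (image_toTrapezoid hn (Q := fun r x x' y' => y' = (r : ℤ) + 2 → x < x')
    fun r s s' => ?_).symm
  simp only [GogamStep]
  omega

open Finset in
theorem ncard_image_toTrapezoid {R : ℕ → ℕ × ℕ → ℕ × ℕ → Prop}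
    (hR : ∀ r s s', R r s s' → s' ∈ stateBox (r + 1)) (N : ℕ) :
    (toTrapezoid (N + 1) '' {f | IsWalk R N f}).ncard =
      ∑ x ∈ range (N + 2), ∑ y ∈ range (N + 2), #(walks R N (x, y)) := by
  rw [(injOn_toTrapezoid R N).ncard_image, ← sum_product',
    ← ncard_walks hR]
  congr 1
  ext f
  exact ⟨fun hf => ⟨hf, hf.mem_stateBox hR⟩, And.left⟩

open Finset in
theorem ncard_image_toTrapezoid_bottom {R : ℕ → ℕ × ℕ → ℕ × ℕ → Prop}
    (hR : ∀ r s s', R r s s' → s' ∈ stateBox (r + 1)) (N l : ℕ) :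
    {X ∈ toTrapezoid (N + 1) '' {f | IsWalk R N f} | X 1 1 = (l : ℤ)}.ncard =
      ∑ y ∈ range (N + 2), #(walks R N (l, y)) := by
  have : {X ∈ toTrapezoid (N + 1) '' {f | IsWalk R N f} | X 1 1 = (l : ℤ)} =
      toTrapezoid (N + 1) '' {f | IsWalk R N f ∧ f N ∈ {l} ×ˢ range (N + 2)} := by
    have hX : ∀ f, toTrapezoid (N + 1) f 1 1 = (f N).1 := fun f =>
      toTrapezoid_one f le_rfl (by omega)
    ext X
    constructor
    · rintro ⟨⟨f, hf, rfl⟩, hl⟩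
      rw [hX, Nat.cast_inj] at hl
      exact ⟨f, ⟨hf, mem_product.2 ⟨mem_singleton.2 hl,
        (mem_product.1 (hf.mem_stateBox hR)).2⟩⟩, rfl⟩
    · rintro ⟨f, ⟨hf, hl⟩, rfl⟩
      refine ⟨⟨f, hf, rfl⟩, ?_⟩
      rw [hX, mem_singleton.1 (mem_product.1 hl).1]
  rw [this, ((injOn_toTrapezoid R N).mono fun f hf => hf.1).ncard_image,
    ncard_walks hR, sum_product, sum_singleton]

end Trapezoids

/-- For every `l ≥ 1`, the `(n,2)` left Gog trapezoids with bottom entry `l` are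
equinumerous with the `(n,2)` left GOGAm trapezoids with bottom entry `l`; in
particular the `(n,2)` left Gog and GOGAm trapezoids are equienumerated. -/
theorem stmt10 (n : ℕ) (hn : 2 ≤ n) :
    (∀ l : ℤ, 1 ≤ l →
      {X ∈ LeftGogTrapezoids n 2 | X 1 1 = l}.ncard =
        {Y ∈ LeftGogamTrapezoids n 2 | Y 1 1 = l}.ncard) ∧
    (LeftGogTrapezoids n 2).ncard = (LeftGogamTrapezoids n 2).ncard := by
  rw [leftGogTrapezoids_eq_image hn, leftGogamTrapezoids_eq_image hn]
  obtain ⟨N, rfl⟩ := Nat.exists_eq_add_of_le' (show 1 ≤ n by omega)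
  rw [Nat.add_sub_cancel]
  refine ⟨fun l hl => ?_, ?_⟩
  · lift l to ℕ using by omega
    rw [ncard_image_toTrapezoid_bottom GogStep.mem_stateBox,
      ncard_image_toTrapezoid_bottom GogamStep.mem_stateBox]
    exact sum_gogCount_eq_sum_gogamCount N l
  · rw [ncard_image_toTrapezoid GogStep.mem_stateBox,
      ncard_image_toTrapezoid GogamStep.mem_stateBox]
    exact Finset.sum_congr rfl fun x _ => sum_gogCount_eq_sum_gogamCount N x
end

section
/- Let n ≥ 3 and let a, b, c, d, e, f be positive integers forming a Gelfand-Tsetlin triangle of size 3 with bottom entry c, middle row (b, e), and top row (a, d, f), i.e. a ≤ b ≤ d ≤ e ≤ f and b ≤ c ≤ e. Then this triangle arises as the bottom three rows of some GOGAm triangle of size n (i.e. it is an (n,3,3,3) GOGAm pentagon) if and only if f ≤ n, f−e+d ≤ n−1, f−c+b ≤ n−1, and f−e+d−b+a ≤ n−2. Consequently, for every n ≥ 3 the number of (n,3,3,3) Gog pentagons (triangles of size 3 as above with a < d < f, b < e, f ≤ n) equals the number of (n,3,3,3) GOGAm pentagons. -/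
/-- `(n,3,3,3)` Gog pentagons, as 6-tuples `(a,b,c,d,e,f)` given by the bottom three
rows of a Gog triangle of size `n`: `c = X 1 1`, `(b,e) = (X 2 1, X 2 2)`,
`(a,d,f) = (X 3 1, X 3 2, X 3 3)`. -/
def GogPentagons (n : ℕ) : Set (ℤ × ℤ × ℤ × ℤ × ℤ × ℤ) :=
  {v | ∃ X : ℕ → ℕ → ℤ, IsGog n X ∧ X 3 1 = v.1 ∧ X 2 1 = v.2.1 ∧ X 1 1 = v.2.2.1 ∧
    X 3 2 = v.2.2.2.1 ∧ X 2 2 = v.2.2.2.2.1 ∧ X 3 3 = v.2.2.2.2.2}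

/-- `(n,3,3,3)` GOGAm pentagons, as 6-tuples `(a,b,c,d,e,f)` given by the bottom three
rows of a GOGAm triangle of size `n`. -/
def GogamPentagons (n : ℕ) : Set (ℤ × ℤ × ℤ × ℤ × ℤ × ℤ) :=
  {v | ∃ X : ℕ → ℕ → ℤ, IsGogam n X ∧ X 3 1 = v.1 ∧ X 2 1 = v.2.1 ∧ X 1 1 = v.2.2.1 ∧
    X 3 2 = v.2.2.2.1 ∧ X 2 2 = v.2.2.2.2.1 ∧ X 3 3 = v.2.2.2.2.2}

/-- The diagonals of a Gelfand-Tsetlin triangle increase weakly. -/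
theorem IsGT.le_diag_s19 {n : ℕ} {X : ℕ → ℕ → ℤ} (h : IsGT n X) {i m : ℕ} (hi : 1 ≤ i)
    (him : i ≤ m) (hm : m ≤ n) : X i i ≤ X m m := by
  induction m, him using Nat.le_induction with
  | base => exact le_rfl
  | succ m him ih => exact (ih (by omega)).trans (h.2 m m (by omega) le_rfl hm).2

/-- The linear inequalities characterizing `(n,3,3,3)` GOGAm pentagons. -/
theorem IsGogam.pentagon_le {n : ℕ} (hn : 3 ≤ n) {X : ℕ → ℕ → ℤ} (h : IsGogam n X) :
    X 3 3 ≤ n ∧ X 3 3 - X 2 2 + X 3 2 ≤ (n : ℤ) - 1 ∧ X 3 3 - X 1 1 + X 2 1 ≤ (n : ℤ) - 1 ∧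
      X 3 3 - X 2 2 + X 3 2 - X 2 1 + X 3 1 ≤ (n : ℤ) - 2 := by
  obtain ⟨hGT, htop, hk⟩ := h
  have hdiag : X 3 3 ≤ X n n := hGT.le_diag_s19 (by norm_num) hn le_rfl
  have one (t : ℕ) (ht : 1 ≤ t) (htn : t < n) :
      X n n - X t t + X (t + 1) t ≤ (n : ℤ) - 1 := by
    have hm : n - (n - 1) = 1 := by omega
    have := hk (n - 1) (by omega) le_rfl (fun i => if i = 0 then n else t) rfl
      (fun i hi => by
        obtain rfl : i = 0 := by omega
        simpa using htn)
      (by simpa [hm] using ht)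
    rw [hm] at this
    simp at this
    omega
  have two : X n n - X 2 2 + (X 3 2 - X 2 1) + X 3 1 ≤ (n : ℤ) - 2 := by
    have hm : n - (n - 2) = 2 := by omega
    have := hk (n - 2) (by omega) (by omega)
      (fun i => if i = 0 then n else if i = 1 then 2 else 1) rfl
      (fun i hi => by
        obtain rfl | rfl : i = 0 ∨ i = 1 := by omega
        · simp; omega
        · simp)
      (by simp [hm])
    rw [hm] at this
    simp [Finset.sum_range_succ] at this
    omega
  have h₁ := one 1 le_rfl (by omega)
  have h₂ := one 2 (by norm_num) (by omega)
  norm_num at h₁ h₂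
  refine ⟨?_, ?_, ?_, ?_⟩ <;> omega

/-- The minimal extension of a triangle of size 3, given through its entries: the entry in
row `i` and column `j` is described in terms of the diagonal `i - j` and of `j`. -/
def gogamFill (a b c d e f : ℤ) (i j : ℕ) : ℤ :=
  if i - j = 0 then (if j = 1 then c else if j = 2 then e else f)
  else if i - j = 1 then (if j = 1 then b else d)
  else if i - j = 2 then a else 1

theorem gogamFill_add (a b c d e f : ℤ) (j s : ℕ) :
    gogamFill a b c d e f (j + s) j =
      if s = 0 then (if j = 1 then c else if j = 2 then e else f)
      else if s = 1 then (if j = 1 then b else d) else if s = 2 then a else 1 := by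
  simp [gogamFill]

theorem isGogam_gogamFill {n : ℕ} (hn : 3 ≤ n) {a b c d e f : ℤ} (ha : 1 ≤ a) (hab : a ≤ b)
    (hbd : b ≤ d) (hde : d ≤ e) (hef : e ≤ f) (hbc : b ≤ c) (hce : c ≤ e)
    (h₁ : f ≤ n) (h₂ : f - e + d ≤ (n : ℤ) - 1) (h₃ : f - c + b ≤ (n : ℤ) - 1)
    (h₄ : f - e + d - b + a ≤ (n : ℤ) - 2) : IsGogam n (gogamFill a b c d e f) := by
  refine ⟨⟨?_, ?_⟩, ?_, ?_⟩
  · intro i j hj hji _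
    obtain ⟨s, rfl⟩ := Nat.exists_eq_add_of_le hji
    rw [gogamFill_add]
    split_ifs <;> omega
  · intro i j hj hji _
    obtain ⟨s, rfl⟩ := Nat.exists_eq_add_of_le hji
    have h₅ := gogamFill_add a b c d e f j (s + 1)
    have h₆ := gogamFill_add a b c d e f (j + 1) s
    rw [add_right_comm] at h₆
    rw [← add_assoc] at h₅
    rw [gogamFill_add _ _ _ _ _ _ j s, h₅, h₆]
    constructor <;> split_ifs <;> grind
  · have := gogamFill_add a b c d e f n 0
    rw [add_zero] at this
    rw [this]
    split_ifs <;> omega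
  · intro k hk hkn j hj₀ hj hjm
    have hcast : (k : ℤ) = n - (n - k : ℕ) := by omega
    have hlow (t : ℕ) (ht : t ≤ n - k) : t + 1 ≤ j (n - k - t) := by
      induction t with
      | zero => simpa using hjm
      | succ t ih =>
        have h := hj (n - k - (t + 1)) (by omega)
        rw [show n - k - (t + 1) + 1 = n - k - t by omega] at h
        have := ih (by omega)
        omega
    have hm₁ : 1 ≤ n - k := by omega
    have hmn : n - k < n := by omega
    rw [hcast]
    simp only [gogamFill_add]
    generalize n - k = m at *
    obtain rfl | rfl | ⟨m, rfl⟩ : m = 1 ∨ m = 2 ∨ ∃ l, m = l + 3 := by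
      obtain h | h | h : m = 1 ∨ m = 2 ∨ 3 ≤ m := by omega
      · exact Or.inl h
      · exact Or.inr (Or.inl h)
      · exact Or.inr (Or.inr ⟨m - 3, by omega⟩)
    · simp [hj₀]
      split_ifs <;> omega
    · have : j 2 < j 1 := hj 1 (by norm_num)
      simp [Finset.sum_range_succ, hj₀]
      split_ifs <;> omega
    · have hj₁ := hlow (m + 2) (by omega)
      have hj₂ := hlow (m + 1) (by omega)
      rw [show m + 3 - (m + 2) = 1 by omega] at hj₁
      rw [show m + 3 - (m + 1) = 2 by omega] at hj₂
      rw [Finset.sum_range_succ', Finset.sum_range_succ', Finset.sum_eq_zero (by simp)]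
      simp [hj₀]
      split_ifs <;> omega

theorem exists_isGogam_iff {n : ℕ} (hn : 3 ≤ n) {a b c d e f : ℤ} (ha : 1 ≤ a) (hab : a ≤ b)
    (hbd : b ≤ d) (hde : d ≤ e) (hef : e ≤ f) (hbc : b ≤ c) (hce : c ≤ e) :
    (∃ X : ℕ → ℕ → ℤ, IsGogam n X ∧ X 1 1 = c ∧ X 2 1 = b ∧ X 2 2 = e ∧
        X 3 1 = a ∧ X 3 2 = d ∧ X 3 3 = f) ↔
      (f ≤ (n : ℤ) ∧ f - e + d ≤ (n : ℤ) - 1 ∧ f - c + b ≤ (n : ℤ) - 1 ∧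
        f - e + d - b + a ≤ (n : ℤ) - 2) := by
  constructor
  · rintro ⟨X, hX, rfl, rfl, rfl, rfl, rfl, rfl⟩
    exact hX.pentagon_le hn
  · rintro ⟨h₁, h₂, h₃, h₄⟩
    exact ⟨gogamFill a b c d e f,
      isGogam_gogamFill hn ha hab hbd hde hef hbc hce h₁ h₂ h₃ h₄, by simp [gogamFill]⟩

/-- The inequalities satisfied by the entries of a Gelfand-Tsetlin triangle of size at
least 3. -/
theorem IsGT.pentagon {n : ℕ} (hn : 3 ≤ n) {X : ℕ → ℕ → ℤ} (h : IsGT n X) :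
    1 ≤ X 3 1 ∧ X 3 1 ≤ X 2 1 ∧ X 2 1 ≤ X 3 2 ∧ X 3 2 ≤ X 2 2 ∧ X 2 2 ≤ X 3 3 ∧
      X 2 1 ≤ X 1 1 ∧ X 1 1 ≤ X 2 2 := by
  have h₁ := h.2 1 1 le_rfl le_rfl (by omega)
  have h₂ := h.2 2 1 le_rfl (by norm_num) (by omega)
  have h₃ := h.2 2 2 (by norm_num) le_rfl (by omega)
  exact ⟨h.1 3 1 le_rfl (by norm_num) hn, h₂.1, h₂.2, h₃.1, h₃.2, h₁.1, h₁.2⟩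

theorem mem_gogamPentagons_iff {n : ℕ} (hn : 3 ≤ n) (a b c d e f : ℤ) :
    (a, b, c, d, e, f) ∈ GogamPentagons n ↔
      (1 ≤ a ∧ a ≤ b ∧ b ≤ d ∧ d ≤ e ∧ e ≤ f ∧ b ≤ c ∧ c ≤ e) ∧
      f ≤ (n : ℤ) ∧ f - e + d ≤ (n : ℤ) - 1 ∧ f - c + b ≤ (n : ℤ) - 1 ∧
        f - e + d - b + a ≤ (n : ℤ) - 2 := by
  constructor
  · rintro ⟨X, hX, rfl, rfl, rfl, rfl, rfl, rfl⟩
    exact ⟨hX.1.pentagon hn, hX.pentagon_le hn⟩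
  · rintro ⟨⟨ha, hab, hbd, hde, hef, hbc, hce⟩, h⟩
    obtain ⟨X, hX, h₁, h₂, h₃, h₄, h₅, h₆⟩ :=
      (exists_isGogam_iff hn ha hab hbd hde hef hbc hce).2 h
    exact ⟨X, hX, h₄, h₂, h₁, h₅, h₃, h₆⟩

/-- The minimal extension to a Gog triangle of a triangle of size 3 with strictly increasing
rows. -/
def gogFill (a b c d e f : ℤ) (i j : ℕ) : ℤ :=
  if i = 1 then c
  else if i = 2 then (if j = 1 then b else e)
  else max (j : ℤ) (if i - j = 0 then f else if i - j = 1 then d else if i - j = 2 then a else 0)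

theorem isGog_gogFill {n : ℕ} (hn : 3 ≤ n) {a b c d e f : ℤ} (ha : 1 ≤ a) (hab : a ≤ b)
    (hbd : b ≤ d) (hde : d ≤ e) (hef : e ≤ f) (hbc : b ≤ c) (hce : c ≤ e)
    (had : a < d) (hdf : d < f) (hbe : b < e) (hf : f ≤ n) :
    IsGog n (gogFill a b c d e f) := by
  refine ⟨⟨?_, ?_⟩, ?_, ?_⟩
  · intro i j hj hji _
    unfold gogFill
    split_ifs <;> omega
  · intro i j hj hji _
    obtain h | h | h : i = 1 ∨ i = 2 ∨ 3 ≤ i := by omega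
    · subst h
      obtain rfl : j = 1 := by omega
      simp [gogFill, hbc, hce]
    · subst h
      obtain rfl | rfl : j = 1 ∨ j = 2 := by omega
      · simp [gogFill]; omega
      · simp [gogFill]; omega
    · unfold gogFill
      constructor <;> split_ifs <;> omega
  · intro i j hj hji _
    unfold gogFill
    split_ifs <;> omega
  · intro j hj hjn
    unfold gogFill
    split_ifs <;> omega

theorem mem_gogPentagons_iff {n : ℕ} (hn : 3 ≤ n) (a b c d e f : ℤ) :
    (a, b, c, d, e, f) ∈ GogPentagons n ↔
      (1 ≤ a ∧ a ≤ b ∧ b ≤ d ∧ d ≤ e ∧ e ≤ f ∧ b ≤ c ∧ c ≤ e) ∧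
      a < d ∧ d < f ∧ b < e ∧ f ≤ (n : ℤ) := by
  constructor
  · rintro ⟨X, ⟨hGT, hlt, htop⟩, rfl, rfl, rfl, rfl, rfl, rfl⟩
    exact ⟨hGT.pentagon hn, hlt 3 1 le_rfl (by norm_num) hn,
      hlt 3 2 (by norm_num) le_rfl hn, hlt 2 1 le_rfl le_rfl (by omega),
      (hGT.le_diag_s19 (by norm_num) hn le_rfl).trans_eq (htop n (by omega) le_rfl)⟩
  · rintro ⟨⟨ha, hab, hbd, hde, hef, hbc, hce⟩, had, hdf, hbe, hf⟩
    refine ⟨gogFill a b c d e f,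
      isGog_gogFill hn ha hab hbd hde hef hbc hce had hdf hbe hf, ?_⟩
    simp [gogFill]
    omega

/-- The piecewise linear bijection from Gog pentagons to GOGAm pentagons. -/
def gogToGogam : ℤ × ℤ × ℤ × ℤ × ℤ × ℤ → ℤ × ℤ × ℤ × ℤ × ℤ × ℤ
  | (a, b, c, d, e, f) =>
    if d = e then
      if a < b then (a, b, c, d, e, f - 1)
      else if b < c then (a, b, c, e - 1, e, f - 1)
      else (a, b, c, b, e, f - 1)
    else if b < c then
      if d = e - 1 ∧ a = b then (a, b, c, b, e, f) else (a, b, c, d, e, f)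
    else if d < e - 1 then (a, b, c, d, e - 1, f - 1)
    else if b < e - 1 then (a, a, b, e - 2, e - 2, f - 2)
    else (a, b, c, d, e - 1, f - 1)

/-- The inverse of `gogToGogam`. -/
def gogamToGog : ℤ × ℤ × ℤ × ℤ × ℤ × ℤ → ℤ × ℤ × ℤ × ℤ × ℤ × ℤ
  | (a, b, c, d, e, f) =>
    if d = e then
      if a = b then (a, c, c, e + 1, e + 2, f + 2)
      else if b = e then (a, b, c, d, e + 1, f + 1)
      else (a, b, c, d, e, f + 1)
    else if b = c then
      if a < d then (a, b, c, d, e + 1, f + 1) else (a, b, c, e, e, f + 1)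
    else if d = e - 1 ∧ a = b then (a, b, c, e, e, f + 1)
    else if a = d then (a, b, c, e - 1, e, f)
    else (a, b, c, d, e, f)

theorem bijOn_gogToGogam {n : ℕ} (hn : 3 ≤ n) :
    Set.BijOn gogToGogam (GogPentagons n) (GogamPentagons n) := by
  refine Set.InvOn.bijOn (f' := gogamToGog) ⟨?_, ?_⟩ ?_ ?_
  · rintro ⟨a, b, c, d, e, f⟩ h
    rw [mem_gogPentagons_iff hn] at h
    dsimp only [gogToGogam]
    split_ifs <;> dsimp only [gogamToGog] <;> split_ifs <;>
      simp only [Prod.mk.injEq, true_and, and_true] <;> omega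
  · rintro ⟨a, b, c, d, e, f⟩ h
    rw [mem_gogamPentagons_iff hn] at h
    dsimp only [gogamToGog]
    split_ifs <;> dsimp only [gogToGogam] <;> split_ifs <;>
      simp only [Prod.mk.injEq, true_and, and_true] <;> omega
  · rintro ⟨a, b, c, d, e, f⟩ h
    rw [mem_gogPentagons_iff hn] at h
    dsimp only [gogToGogam]
    split_ifs <;> rw [mem_gogamPentagons_iff hn] <;> omega
  · rintro ⟨a, b, c, d, e, f⟩ h
    rw [mem_gogamPentagons_iff hn] at h
    dsimp only [gogamToGog]
    split_ifs <;> rw [mem_gogPentagons_iff hn] <;> omega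

/-- Characterization of `(n,3,3,3)` GOGAm pentagons: a Gelfand-Tsetlin triangle of size
3 (bottom `c`, middle row `(b,e)`, top row `(a,d,f)`) is the bottom three rows of a
GOGAm triangle of size `n` iff `f ≤ n`, `f - e + d ≤ n - 1`, `f - c + b ≤ n - 1` and
`f - e + d - b + a ≤ n - 2`; consequently the `(n,3,3,3)` Gog and GOGAm pentagons are
equienumerated. -/
theorem stmt19 (n : ℕ) (hn : 3 ≤ n) :
    (∀ a b c d e f : ℤ, 1 ≤ a → a ≤ b → b ≤ d → d ≤ e → e ≤ f → b ≤ c → c ≤ e →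
      ((∃ X : ℕ → ℕ → ℤ, IsGogam n X ∧ X 1 1 = c ∧ X 2 1 = b ∧ X 2 2 = e ∧
          X 3 1 = a ∧ X 3 2 = d ∧ X 3 3 = f) ↔
        (f ≤ (n : ℤ) ∧ f - e + d ≤ (n : ℤ) - 1 ∧ f - c + b ≤ (n : ℤ) - 1 ∧
          f - e + d - b + a ≤ (n : ℤ) - 2))) ∧
    (GogPentagons n).ncard = (GogamPentagons n).ncard := by
  refine ⟨fun a b c d e f ha hab hbd hde hef hbc hce =>
    exists_isGogam_iff hn ha hab hbd hde hef hbc hce, ?_⟩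
  have h := bijOn_gogToGogam hn
  rw [← h.image_eq, h.injOn.ncard_image]
end
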